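/- arXiv:2301.10305 — 2 statements merged into one kernel-verified Lean document; each statement's English description precedes it below -/
import Mathlib

section
/- For every s ≥ 1 there exists n such that the hat guessing game on the petal graph Pe_n with constant hatness 4s(s+1)−2 and s guesses per vertex is winning; hence HG_s(Pe_n) = 4s(s+1)−2 for sufficiently large n, and the supremum of HG_s over all petal graphs equals 4s(s+1)−2. -/
/-- A winning strategy in the hat guessing game `⟨G, h, g⟩`: each sage `v` deterministically
outputs at most `g v` guesses depending only on the hat colors of its neighbors, and for
every hat assignment (with `c v < h v`) some sage's guess set contains its own color. -/
def HatWinning {V : Type*} (G : SimpleGraph V) (h g : V → ℕ) : Prop :=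
  ∃ σ : V → (V → ℕ) → Finset ℕ,
    (∀ v c c', (∀ u, G.Adj v u → c u = c' u) → σ v c = σ v c') ∧
    (∀ v c, (σ v c).card ≤ g v) ∧
    ∀ c : V → ℕ, (∀ v, c v < h v) → ∃ v, c v ∈ σ v c

/-- The hat guessing game played by the sages occupying the vertices of `S` only
(the game on the induced subgraph `G[S]`). -/
def HatWinningOn {V : Type*} (G : SimpleGraph V) (S : Set V) (h g : V → ℕ) : Prop :=
  ∃ σ : V → (V → ℕ) → Finset ℕ,
    (∀ v ∈ S, ∀ c c', (∀ u ∈ S, G.Adj v u → c u = c' u) → σ v c = σ v c') ∧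
    (∀ v ∈ S, ∀ c, (σ v c).card ≤ g v) ∧
    ∀ c : V → ℕ, (∀ v ∈ S, c v < h v) → ∃ v ∈ S, c v ∈ σ v c

/-- The petal graph `Pe_n`: the path on `Fin n` together with a stem (`none`) adjacent to
every path vertex. -/
def petal (n : ℕ) : SimpleGraph (Option (Fin n)) :=
  SimpleGraph.fromRel (fun x y =>
    x = none ∨ ∃ i j : Fin n, x = some i ∧ y = some j ∧ (i : ℕ) + 1 = (j : ℕ))

lemma petal_adj_none {n : ℕ} (i : Fin n) : (petal n).Adj none (some i) := by
  simp [petal]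

lemma petal_adj_some {n : ℕ} (i : Fin n) (v : Option (Fin n)) (h : (petal n).Adj (some i) v) :
    v = none ∨ ∃ j : Fin n, v = some j ∧ ((i : ℕ) + 1 = j ∨ (j : ℕ) + 1 = i) := by
  cases v with
  | none => left; rfl
  | some j =>
    right
    refine ⟨j, rfl, ?_⟩
    simpa [petal, SimpleGraph.fromRel_adj] using h.2 

lemma petal_adj_some_of {n : ℕ} (i j : Fin n) (h : (i : ℕ) + 1 = j ∨ (j : ℕ) + 1 = i) :
    (petal n).Adj (some i) (some j) := by
  rw [petal, SimpleGraph.fromRel_adj]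
  refine ⟨?_, ?_⟩
  · intro e
    have e' := Option.some.inj e
    subst e'
    omega
  · rcases h with h | h
    · left; right; exact ⟨i, j, rfl, rfl, h⟩
    · right; right; exact ⟨j, i, rfl, rfl, h⟩

/-- The path with `g` guesses and hatness `4g-1` is losing. -/
lemma path_losing (g : ℕ) (hg : 1 ≤ g) (G : ℕ → ℕ → ℕ → Finset ℕ)
    (hG : ∀ p x z, (G p x z).card ≤ g) (m : ℕ) : ∀ z < 4 * g - 1,
    ∃ B : Finset ℕ, B.card ≤ 2 * g - 1 ∧ ∀ y < 4 * g - 1, y ∉ B →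
      ∃ d : ℕ → ℕ, (∀ p, d p < 4 * g - 1) ∧ d m = y ∧ d (m + 1) = z ∧
        ∀ p, 1 ≤ p → p ≤ m → d p ∉ G p (d (p - 1)) (d (p + 1)) := by
  induction m with
  | zero =>
    intro z hz
    refine ⟨∅, by simp, fun y hy _ => ⟨fun p => if p = 0 then y else z, ?_, ?_, ?_, ?_⟩⟩
    · intro p; dsimp only; split_ifs <;> assumption
    · simp
    · simp
    · intro p h1 h2; omega
  | succ m ih =>
    intro w hw
    choose! B hB hd using ih
    classical
    let C : Finset ℕ := (Finset.range (4 * g - 1)).filter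
      (fun z => ∀ y < 4 * g - 1, y ∉ B z → z ∈ G (m + 1) y w)
    refine ⟨C, ?_, ?_⟩
    · have h1 : C.card * (2 * g) ≤ (Finset.range (4 * g - 1)).card * g := by
        refine Finset.card_mul_le_card_mul (fun z y => y ∉ B z) (s := C)
          (t := Finset.range (4 * g - 1)) ?_ ?_
        · intro z hz
          have hz' : z < 4 * g - 1 := by
            have := (Finset.mem_filter.1 hz).1
            simpa using this
          have e : Finset.bipartiteAbove (fun z y => y ∉ B z) (Finset.range (4 * g - 1)) z
              = Finset.range (4 * g - 1) \ B z := by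
            ext y; simp [Finset.bipartiteAbove]
          rw [e]
          have h2 := Finset.le_card_sdiff (B z) (Finset.range (4 * g - 1))
          have h3 := hB z hz'
          rw [Finset.card_range] at h2
          omega
        · intro y hy
          refine le_trans (Finset.card_le_card ?_) (hG (m + 1) y w)
          intro z hz
          rw [Finset.mem_bipartiteBelow] at hz
          exact (Finset.mem_filter.1 hz.1).2 y (by simpa using hy) hz.2
      rw [Finset.card_range] at h1
      have h2 : C.card * 2 ≤ 4 * g - 1 := by
        have : g * (C.card * 2) ≤ g * (4 * g - 1) := by linarith
        exact Nat.le_of_mul_le_mul_left this (by omega)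
      omega
    · intro z hz hzC
      have : ∃ y < 4 * g - 1, y ∉ B z ∧ z ∉ G (m + 1) y w := by
        by_contra hcon
        push Not at hcon
        exact hzC (Finset.mem_filter.2 ⟨by simpa using hz, hcon⟩)
      obtain ⟨y, hy, hyB, hyG⟩ := this
      obtain ⟨d, hd1, hd2, hd3, hd4⟩ := hd z hz y hy hyB
      refine ⟨fun p => if p ≤ m + 1 then d p else w, ?_, ?_, ?_, ?_⟩
      · intro p; dsimp only; split_ifs
        · exact hd1 p
        · exact hw
      · simp [hd3]
      · simp
      · intro p h1 h2
        rcases Nat.lt_or_ge m p with h | h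
        · obtain rfl : p = m + 1 := by omega
          simp [hd2, hd3, hyG]
        · have := hd4 p h1 h
          dsimp only
          rw [if_pos h2, if_pos (by omega), if_pos (by omega)]
          exact this

lemma petal_upper (s : ℕ) (hs : 1 ≤ s) (n k : ℕ)
    (hw : HatWinning (petal n) (fun _ => k) (fun _ => s)) : k ≤ 4 * s * (s + 1) - 2 := by
  classical
  by_contra hk
  obtain ⟨σ, hloc, hcard, hwin⟩ := hw
  obtain ⟨g, hgdef⟩ : ∃ g, g = (s + 1) * s := ⟨_, rfl⟩
  have hg4 : 4 * s * (s + 1) = 4 * g := by rw [hgdef]; ring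
  have hgs : s + 1 ≤ g := by rw [hgdef]; nlinarith
  rw [hg4] at hk
  let col : ℕ → ℕ → ℕ → ℕ → Option (Fin n) → ℕ := fun p x z a v =>
    v.elim a (fun q => if q.1 + 1 < p then x else z)
  let G : ℕ → ℕ → ℕ → Finset ℕ := fun p x z =>
    if hp : p - 1 < n then
      (Finset.range (s + 1)).biUnion (fun a => σ (some ⟨p - 1, hp⟩) (col p x z a)) else ∅
  have hG : ∀ p x z, (G p x z).card ≤ g := by
    intro p x z
    by_cases hp : p - 1 < n
    · simp only [G, dif_pos hp]
      refine (Finset.card_biUnion_le_card_mul _ _ s (fun a _ => hcard _ _)).trans ?_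
      simp [hgdef]
    · simp [G, hp]
  obtain ⟨B, hB, hd⟩ := path_losing g (by omega) G hG n 0 (by omega)
  obtain ⟨y, hy, hyB⟩ : ∃ y ∈ Finset.range (4 * g - 1), y ∉ B := by
    apply Finset.exists_mem_notMem_of_card_lt_card
    rw [Finset.card_range]; omega
  obtain ⟨d, hd1, -, -, hd4⟩ := hd y (by simpa using hy) hyB
  let c : ℕ → Option (Fin n) → ℕ := fun a v => v.elim a (fun q => d (q.1 + 1))
  obtain ⟨a, ha, haσ⟩ : ∃ a ∈ Finset.range (s + 1), a ∉ σ none (c 0) := by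
    apply Finset.exists_mem_notMem_of_card_lt_card
    rw [Finset.card_range]
    exact Nat.lt_succ_of_le (hcard none (c 0))
  obtain ⟨v, hv⟩ := hwin (c a) (by
    intro v
    cases v with
    | none => simp [c]; simp at ha; omega
    | some q => have := hd1 (q.1 + 1); simp [c]; omega)
  cases v with
  | none =>
    have e : σ none (c a) = σ none (c 0) := by
      apply hloc
      intro u hu
      cases u with
      | none => exact absurd hu (SimpleGraph.irrefl _)
      | some q => rfl
    rw [e] at hv
    exact haσ hv
  | some q =>
    apply hd4 (q.1 + 1) (by omega) q.2
    have hq : q.1 + 1 - 1 < n := by have := q.2; omega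
    simp only [G, dif_pos hq, Finset.mem_biUnion]
    refine ⟨a, ha, ?_⟩
    have e : σ (some q) (c a) = σ (some q) (col (q.1 + 1) (d (q.1 + 1 - 1)) (d (q.1 + 1 + 1)) a) := by
      apply hloc
      intro u hu
      rcases petal_adj_some q u hu with rfl | ⟨j, rfl, h | h⟩
      · rfl
      · simp only [c, col, Option.elim]
        rw [if_neg (by omega), h]
      · simp only [c, col, Option.elim]
        rw [if_pos (by omega)]; congr 1
    rw [e] at hv
    exact hv

/-- The (cyclic) interval of colours used for the winning strategy on a path. -/
def cycInt (h l z x : ℕ) : Prop := ∃ r < l, x = (l * z + r) % h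

open Classical in
/-- The winning strategy on a path. -/
noncomputable def pathGuess (h i x z : ℕ) : Finset ℕ :=
  if i = 0 then ∅ else
  (Finset.range h).filter (fun y => ¬ cycInt h (h - i) z y ∧ cycInt h (h - i + 1) y x)

lemma cycInt_compl {h i z y : ℕ} (hi : i ≤ h) (hy : y < h) (hn : ¬ cycInt h (h - i) z y) :
    ∃ r < i, y = ((h - i) * z + (h - i) + r) % h := by
  have hh : 0 < h := by omega
  -- the offset of `y` from the start of the interval
  obtain ⟨t, ht, hty⟩ : ∃ t < h, y = ((h - i) * z + t) % h := by
    refine ⟨(y + (h - ((h - i) * z) % h)) % h, Nat.mod_lt _ hh, ?_⟩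
    have h1 : ((h - i) * z) % h < h := Nat.mod_lt _ hh
    rw [Nat.add_mod_mod]
    have h2 : (h - i) * z + (y + (h - ((h - i) * z) % h)) = y + h * (((h - i) * z) / h + 1) := by
      have h3 := Nat.div_add_mod ((h - i) * z) h
      rw [mul_add]
      omega
    rw [h2, Nat.add_mul_mod_self_left, Nat.mod_eq_of_lt hy]
  by_cases htl : t < h - i
  · exact absurd ⟨t, htl, hty⟩ hn
  · refine ⟨t - (h - i), by omega, ?_⟩
    rw [hty]; congr 1; omega

lemma pathGuess_card (g i x z : ℕ) (hg : 1 ≤ g) (hi : i ≤ 4 * g - 2) :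
    (pathGuess (4 * g - 2) i x z).card ≤ g := by
  classical
  by_cases hi0 : i = 0
  · simp [pathGuess, hi0]
  obtain ⟨h, hh⟩ : ∃ h, h = 4 * g - 2 := ⟨_, rfl⟩
  rw [← hh] at hi ⊢
  have hbound : (h - i + 1) * i ≤ h * g := by
    obtain ⟨m, hm⟩ : ∃ m, m = h - i + 1 := ⟨_, rfl⟩
    rw [← hm]
    have h1 : m + i = 4 * g - 1 := by omega
    zify
    have h2 : (m : ℤ) + i = 4 * g - 1 := by omega
    have h3 : (h : ℤ) = 4 * g - 2 := by omega
    have h4 : (m : ℤ) = 4 * g - 1 - i := by linarith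
    rw [h3, h4]
    rcases le_or_gt (i : ℤ) (2 * g - 1) with h5 | h5
    · nlinarith
    · nlinarith [mul_nonneg (by linarith : (0:ℤ) ≤ i - 2 * g) (by linarith : (0:ℤ) ≤ i - 2 * g)]
  let m := h - i + 1
  let a := (h - i) * z + (h - i)
  have key : ∀ y ∈ pathGuess h i x z, ∃ r r', r < i ∧ r' < m ∧ y = (a + r) % h ∧
      x = (m * y + r') % h := by
    intro y hy
    rw [pathGuess, if_neg hi0, Finset.mem_filter, Finset.mem_range] at hy
    obtain ⟨hy1, hy2, r', hr', hx⟩ := hy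
    obtain ⟨r, hr, hyr⟩ := cycInt_compl hi hy1 hy2
    exact ⟨r, r', hr, hr', hyr, hx⟩
  choose! r r' hr hr' hy hx using key
  have hh0 : 0 < h := by omega
  rw [← Finset.card_range g]
  refine Finset.card_le_card_of_injOn (fun y => (m * r y + r' y) / h) ?_ ?_
  · intro y hyG
    have h1 := hr y hyG
    have h2 := hr' y hyG
    simp only [Finset.coe_range, Set.mem_Iio]
    rw [Nat.div_lt_iff_lt_mul hh0]
    have h3 : m * (r y + 1) ≤ m * i := Nat.mul_le_mul_left _ h1
    have h4 : m * i ≤ h * g := hbound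
    rw [mul_add] at h3
    linarith
  · intro y hyG y' hyG' heq
    simp only at heq
    have e : ∀ y ∈ pathGuess h i x z, (m * a + (m * r y + r' y)) % h = x := by
      intro y hyG
      conv_rhs => rw [hx y hyG]
      have h1 : m * y ≡ m * (a + r y) [MOD h] := by
        apply Nat.ModEq.mul_left
        conv_lhs => rw [hy y hyG]
        exact Nat.mod_modEq _ _
      have h2 := (h1.add_right (r' y)).symm
      rw [mul_add, add_assoc] at h2
      exact h2
    have h1 : m * r y + r' y ≡ m * r y' + r' y' [MOD h] := by
      apply Nat.ModEq.add_left_cancel' (m * a)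
      exact (e y hyG).trans (e y' hyG').symm
    have h2 : m * r y + r' y = m * r y' + r' y' := by
      rw [← Nat.div_add_mod (m * r y + r' y) h, ← Nat.div_add_mod (m * r y' + r' y') h, heq, h1]
    have h3 : r y = r y' := by
      have hm : 0 < m := by simp [m]
      have h4 := congrArg (· / m) h2
      simp only [Nat.mul_add_div hm, Nat.div_eq_of_lt (hr' y hyG),
        Nat.div_eq_of_lt (hr' y' hyG'), add_zero] at h4
      exact h4
    rw [hy y hyG, hy y' hyG', h3]

lemma path_winning (h : ℕ) (d : ℕ → ℕ) (hd : ∀ i ≤ h, d i < h) :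
    ∃ i, 1 ≤ i ∧ i ≤ h ∧ d i ∈ pathGuess h i (d (i - 1)) (d (i + 1)) := by
  classical
  by_contra hcon
  push Not at hcon
  have key : ∀ i ≤ h, cycInt h (h - i) (d (i + 1)) (d i) := by
    intro i
    induction i with
    | zero =>
      intro _
      refine ⟨d 0, hd 0 (by omega), ?_⟩
      simp [Nat.mod_eq_of_lt (hd 0 (by omega))]
    | succ i ih =>
      intro hi
      by_contra hno
      apply hcon (i + 1) (by omega) hi
      rw [pathGuess, if_neg (by omega), Finset.mem_filter, Finset.mem_range]
      refine ⟨hd _ hi, hno, ?_⟩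
      have e : h - (i + 1) + 1 = h - i := by omega
      rw [e]
      exact ih (by omega)
  obtain ⟨r, hr, -⟩ := key h le_rfl
  omega

lemma split_guess (s : ℕ) (S : Finset ℕ) : ∀ G : Finset ℕ, G.card ≤ S.card * s →
    ∃ P : ℕ → Finset ℕ, (∀ a, (P a).card ≤ s) ∧ ∀ y ∈ G, ∃ a ∈ S, y ∈ P a := by
  classical
  induction S using Finset.induction_on with
  | empty =>
    intro G hG
    refine ⟨fun _ => ∅, by simp, ?_⟩
    have : G = ∅ := by simpa using hG
    simp [this]
  | insert a S ha ih =>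
    intro G hG
    rw [Finset.card_insert_of_notMem ha, add_mul, one_mul] at hG
    obtain ⟨G', hG', hc⟩ := Finset.exists_subset_card_eq (min_le_right s G.card)
    obtain ⟨P, hP1, hP2⟩ := ih (G \ G') (by
      rw [Finset.card_sdiff_of_subset hG']
      omega)
    refine ⟨Function.update P a G', ?_, ?_⟩
    · intro b
      by_cases hb : b = a
      · subst hb; simp [hc]
      · simp [Function.update_of_ne hb, hP1]
    · intro y hy
      by_cases hyG : y ∈ G'
      · exact ⟨a, by simp, by simpa using hyG⟩
      · obtain ⟨b, hb, hyb⟩ := hP2 y (by simp [hy, hyG])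
        refine ⟨b, by simp [hb], ?_⟩
        rw [Function.update_of_ne]
        · exact hyb
        · rintro rfl; exact ha hb

lemma petal_lower (s : ℕ) (hs : 1 ≤ s) : ∃ N : ℕ, ∀ n ≥ N,
      HatWinning (petal n) (fun _ => 4 * s * (s + 1) - 2) (fun _ => s) := by
  classical
  obtain ⟨g, hgdef⟩ : ∃ g, g = (s + 1) * s := ⟨_, rfl⟩
  have hg4 : 4 * s * (s + 1) = 4 * g := by rw [hgdef]; ring
  have hgs : s + 1 ≤ g := by rw [hgdef]; nlinarith
  rw [hg4]
  obtain ⟨h, hh⟩ : ∃ h, h = 4 * g - 2 := ⟨_, rfl⟩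
  rw [← hh]
  let Q := Finset.powersetCard (s + 1) (Finset.range h)
  obtain ⟨T, hT⟩ : ∃ T : ℕ → Finset ℕ, ∀ S ∈ Q, ∃ b < Q.card, T b = S := by
    refine ⟨fun b => if hb : b < Q.card then (Q.equivFin.symm ⟨b, hb⟩ : Finset ℕ) else ∅, ?_⟩
    intro S hS
    refine ⟨(Q.equivFin ⟨S, hS⟩).1, (Q.equivFin ⟨S, hS⟩).2, ?_⟩
    simp
  -- splitting of the guesses
  have hsplit : ∀ S G : Finset ℕ, ∃ P : ℕ → Finset ℕ, (∀ a, (P a).card ≤ s) ∧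
      (G.card ≤ S.card * s → ∀ y ∈ G, ∃ a ∈ S, y ∈ P a) := by
    intro S G
    by_cases hG : G.card ≤ S.card * s
    · obtain ⟨P, h1, h2⟩ := split_guess s S G hG
      exact ⟨P, h1, fun _ => h2⟩
    · exact ⟨fun _ => ∅, by simp, fun h => absurd h hG⟩
  choose P hP1 hP2 using hsplit
  refine ⟨Q.card * (h + 1), fun n hn => ?_⟩
  let cc : (Option (Fin n) → ℕ) → ℕ → ℕ := fun c p => if hp : p < n then c (some ⟨p, hp⟩) else 0
  -- guesses of path sages
  let τ : Fin n → (Option (Fin n) → ℕ) → Finset ℕ := fun p c =>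
    if p.1 % (h + 1) = 0 then ∅ else
    P (T (p.1 / (h + 1))) (pathGuess h (p.1 % (h + 1)) (cc c (p.1 - 1)) (cc c (p.1 + 1))) (c none)
  let σ : Option (Fin n) → (Option (Fin n) → ℕ) → Finset ℕ := fun v c =>
    v.elim (if ∀ p, c (some p) < h then
      (Finset.range h).filter (fun a => ∀ p : Fin n, c (some p) ∉ τ p (Function.update c none a))
      else ∅) (fun p => τ p c)
  refine ⟨σ, ?_, ?_, ?_⟩
  · intro v c c' hc
    cases v with
    | none =>
      have h1 : ∀ p, c (some p) = c' (some p) := fun p => hc _ (petal_adj_none p)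
      have h2 : ∀ a, Function.update c none a = Function.update c' none a := by
        intro a; funext v
        cases v with
        | none => simp
        | some p => simp [h1]
      simp only [σ, Option.elim, h1, h2]
    | some p =>
      simp only [σ, Option.elim, τ]
      split_ifs with h0
      · rfl
      have h1 : c none = c' none := hc _ (petal_adj_none p).symm
      have h2 : cc c (p.1 - 1) = cc c' (p.1 - 1) := by
        have hp0 : p.1 ≠ 0 := by
          intro e; rw [e] at h0; simp at h0
        simp only [cc]
        split_ifs with hp
        · apply hc
          apply petal_adj_some_of
          right; simp; omega
        · rfl
      have h3 : cc c (p.1 + 1) = cc c' (p.1 + 1) := by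
        simp only [cc]
        split_ifs with hp
        · apply hc
          apply petal_adj_some_of
          left; simp
        · rfl
      rw [h1, h2, h3]
  · intro v c
    cases v with
    | some p =>
      simp only [σ, Option.elim, τ]
      split_ifs
      · simp
      · exact hP1 _ _ _
    | none =>
      simp only [σ, Option.elim]
      split_ifs with hleg
      swap
      · simp
      by_contra hbig
      push Not at hbig
      obtain ⟨S, hS, hSc⟩ := Finset.exists_subset_card_eq (Nat.succ_le_of_lt hbig)
      have hSQ : S ∈ Q := by
        rw [Finset.mem_powersetCard]
        exact ⟨hS.trans (Finset.filter_subset _ _), hSc⟩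
      obtain ⟨b, hb, hTb⟩ := hT S hSQ
      have hpos : ∀ i ≤ h, b * (h + 1) + i < n := by
        intro i hi
        have : (b + 1) * (h + 1) ≤ Q.card * (h + 1) := Nat.mul_le_mul_right _ hb
        rw [add_mul, one_mul] at this
        omega
      obtain ⟨i, hi1, hi2, hi3⟩ := path_winning h (fun i => cc c (b * (h + 1) + i)) (by
        intro i hi
        simp only [cc, dif_pos (hpos i hi)]
        exact hleg _)
      have hcard := pathGuess_card g i (cc c (b * (h + 1) + (i - 1))) (cc c (b * (h + 1) + (i + 1)))
        (by omega) (by omega)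
      rw [← hh] at hcard
      obtain ⟨a, haS, ha⟩ := hP2 S _ (by rw [hSc]; exact hcard.trans hgdef.le) _ hi3
      have hlose := (Finset.mem_filter.1 (hS haS)).2 ⟨b * (h + 1) + i, hpos i hi2⟩
      apply hlose
      have e1 : (b * (h + 1) + i) % (h + 1) = i := by
        rw [mul_comm, Nat.mul_add_mod, Nat.mod_eq_of_lt (by omega)]
      have e2 : (b * (h + 1) + i) / (h + 1) = b := by
        rw [mul_comm, Nat.mul_add_div (by omega), Nat.div_eq_of_lt (by omega), add_zero]
      have e3 : ∀ p, cc (Function.update c none a) p = cc c p := by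
        intro p; simp [cc]
      simp only [τ, e1, e2, e3, hTb]
      rw [if_neg (by omega)]
      have e4 : b * (h + 1) + i - 1 = b * (h + 1) + (i - 1) := by omega
      rw [e4, add_assoc, Function.update_self]
      simp only [cc, dif_pos (hpos i hi2)] at ha ⊢
      exact ha
  · intro c hc
    by_contra hcon
    push Not at hcon
    apply hcon none
    simp only [σ, Option.elim]
    rw [if_pos (fun p => hc _), Finset.mem_filter, Finset.mem_range]
    refine ⟨hc none, fun p => ?_⟩
    rw [Function.update_eq_self]
    exact hcon (some p)

/-- For every `s ≥ 1`, for all sufficiently large `n` the game on the petal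
`Pe_n` with constant hatness `4s(s+1)-2` and `s` guesses per vertex is winning, and moreover
`HG_s(Pe_n) = 4s(s+1)-2` for such `n`. -/
theorem petal_winning (s : ℕ) (hs : 1 ≤ s) :
    ∃ N : ℕ, ∀ n ≥ N,
      HatWinning (petal n) (fun _ => 4 * s * (s + 1) - 2) (fun _ => s) ∧
      ∀ k, HatWinning (petal n) (fun _ => k) (fun _ => s) → k ≤ 4 * s * (s + 1) - 2 := by
  obtain ⟨N, hN⟩ := petal_lower s hs
  exact ⟨N, fun n hn => ⟨hN n hn, fun k hk => petal_upper s hs n k hk⟩⟩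
end

section
/- For every s ≥ 1 and every royal petunia G, HG_s(G) ≤ 4s(s+1)−2, and this bound is attained by royal petunias containing a sufficiently large petal; hence the supremum of HG_s over royal petunias is 4s(s+1)−2. -/
/-- Glue a new petal with `n+1` path vertices onto the graph `G`, identifying the stem of
the petal with the vertex `v` of `G`. -/
def gluePetal {V : Type} (G : SimpleGraph V) (v : V) (n : ℕ) :
    SimpleGraph (V ⊕ Fin (n + 1)) :=
  SimpleGraph.fromRel (fun x y =>
    (∃ a b : V, x = Sum.inl a ∧ y = Sum.inl b ∧ G.Adj a b) ∨
    (∃ i : Fin (n + 1), x = Sum.inl v ∧ y = Sum.inr i) ∨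
    (∃ i j : Fin (n + 1), x = Sum.inr i ∧ y = Sum.inr j ∧ (i : ℕ) + 1 = (j : ℕ)))

/-- Royal petunias: start from a petal (a single vertex with a petal glued at its stem) and
repeatedly glue the stem of a new petal onto an arbitrary existing vertex. -/
inductive IsRoyalPetunia : {V : Type} → SimpleGraph V → Prop
  | base (n : ℕ) : IsRoyalPetunia (gluePetal (⊥ : SimpleGraph PUnit) PUnit.unit n)
  | glue {V : Type} {G : SimpleGraph V} (hG : IsRoyalPetunia G) (v : V) (n : ℕ) :
      IsRoyalPetunia (gluePetal G v n)


/-! ### Upper bound -/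

/-- On a path with hatness `4t-1` and `t` guesses, from the left: many good continuations. -/
lemma path_lose_aux (t : ℕ) (ht : 1 ≤ t) (G : ℕ → ℕ → ℕ → Finset ℕ)
    (hG : ∀ p z y, (G p z y).card ≤ t) (p : ℕ) :
    ∀ y, y < 4 * t - 1 → ∃ D : Finset ℕ, D ⊆ Finset.range (4 * t - 1) ∧ 2 * t ≤ D.card ∧
      ∀ x ∈ D, ∃ e : ℕ → ℕ, (∀ i, e i < 4 * t - 1) ∧ e p = x ∧ e (p + 1) = y ∧
        ∀ j < p, e (j + 1) ∉ G j (e j) (e (j + 2)) := by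
  induction p with
  | zero =>
    intro y hy
    refine ⟨Finset.range (4 * t - 1), subset_rfl, by simp; omega, ?_⟩
    intro x hx
    rw [Finset.mem_range] at hx
    refine ⟨fun i => if i = 0 then x else y, ?_, by simp, by simp, by simp⟩
    intro i
    dsimp only
    split_ifs <;> assumption
  | succ p ih =>
    intro y hy
    classical
    choose! D hD1 hD2 hD3 using ih
    set h := 4 * t - 1 with hh
    let bad := (Finset.range h).filter (fun x => ∀ z ∈ D x, x ∈ G p z y)
    let good := (Finset.range h).filter (fun x => ¬ ∀ z ∈ D x, x ∈ G p z y)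
    have hsum : bad.card + good.card = h := by
      have := Finset.card_filter_add_card_filter_not (s := Finset.range h)
        (fun x => ∀ z ∈ D x, x ∈ G p z y)
      simpa [bad, good] using this
    have hcount : bad.card * (2 * t) ≤ (Finset.range h).card * t := by
      apply Finset.card_mul_le_card_mul (fun x z => z ∈ D x ∧ x ∈ G p z y)
      · intro x hx
        simp only [bad, Finset.mem_filter, Finset.mem_range] at hx
        refine (hD2 x hx.1).trans (Finset.card_le_card ?_)
        intro z hz
        rw [Finset.mem_bipartiteAbove]
        exact ⟨hD1 x hx.1 hz, hz, hx.2 z hz⟩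
      · intro z hz
        refine (Finset.card_le_card ?_).trans (hG p z y)
        intro x hx
        rw [Finset.mem_bipartiteBelow] at hx
        exact hx.2.2
    rw [Finset.card_range] at hcount
    have hb : bad.card ≤ 2 * t - 1 := by
      have h1 : bad.card * 2 ≤ h := by
        apply Nat.le_of_mul_le_mul_right _ (show 0 < t by omega)
        linarith
      omega
    refine ⟨good, Finset.filter_subset _ _, by omega, ?_⟩
    intro x hx
    simp only [good, Finset.mem_filter, Finset.mem_range] at hx
    obtain ⟨hxh, hx2⟩ := hx
    push Not at hx2
    obtain ⟨z, hz, hzG⟩ := hx2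
    obtain ⟨e, he1, he2, he3, he4⟩ := hD3 x hxh z hz
    refine ⟨Function.update e (p + 2) y, ?_, ?_, ?_, ?_⟩
    · intro i
      rcases eq_or_ne i (p + 2) with rfl | hi
      · simpa using hy
      · simpa [Function.update_of_ne hi] using he1 i
    · rw [Function.update_of_ne (by omega)]; exact he3
    · simp
    · intro j hj
      rw [Function.update_of_ne (show j + 1 ≠ p + 2 by omega),
        Function.update_of_ne (show j ≠ p + 2 by omega)]
      rcases eq_or_ne j p with rfl | hjp
      · rw [Function.update_self, he2, he3]; exact hzG
      · rw [Function.update_of_ne (by omega)]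
        exact he4 j (by omega)

lemma path_lose (t : ℕ) (ht : 1 ≤ t) (G : ℕ → ℕ → ℕ → Finset ℕ)
    (hG : ∀ p z y, (G p z y).card ≤ t) (n : ℕ) :
    ∃ e : ℕ → ℕ, (∀ i, e i < 4 * t - 1) ∧
        ∀ j < n, e (j + 1) ∉ G j (e j) (e (j + 2)) := by
  obtain ⟨D, _, hD2, hD3⟩ := path_lose_aux t ht G hG n 0 (by omega)
  obtain ⟨x, hx⟩ := Finset.card_pos.1 (show 0 < D.card by omega)
  obtain ⟨e, he1, _, _, he4⟩ := hD3 x hx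
  exact ⟨e, he1, he4⟩

lemma glue_adj_inl_inl {V : Type} (G : SimpleGraph V) (v : V) (n : ℕ) (a b : V) :
    (gluePetal G v n).Adj (Sum.inl a) (Sum.inl b) ↔ G.Adj a b := by
  simp only [gluePetal, SimpleGraph.fromRel_adj]
  constructor
  · rintro ⟨-, h⟩
    simp at h
    exact h.elim id (fun h => h.symm)
  · intro h
    exact ⟨by simpa using h.ne, Or.inl (Or.inl ⟨a, b, rfl, rfl, h⟩)⟩

lemma glue_adj_inl_inr {V : Type} (G : SimpleGraph V) (v : V) (n : ℕ) (a : V) (i : Fin (n + 1)) :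
    (gluePetal G v n).Adj (Sum.inl a) (Sum.inr i) ↔ a = v := by
  simp [gluePetal, SimpleGraph.fromRel_adj]

lemma glue_adj_inr_inr {V : Type} (G : SimpleGraph V) (v : V) (n : ℕ) (i j : Fin (n + 1)) :
    (gluePetal G v n).Adj (Sum.inr i) (Sum.inr j) ↔
      ((i : ℕ) + 1 = j ∨ (j : ℕ) + 1 = i) := by
  simp only [gluePetal, SimpleGraph.fromRel_adj]
  constructor
  · rintro ⟨-, h⟩
    simpa using h
  · intro h
    refine ⟨?_, by simpa using h⟩
    rintro h'
    rw [Sum.inr.injEq] at h'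
    subst h'
    omega

/-- A petal whose stem is restricted to `s+1` colors is losing. -/
lemma petal_lose {V : Type} (G : SimpleGraph V) (v : V) (n s : ℕ) (hs : 1 ≤ s)
    (σ : (V ⊕ Fin (n + 1)) → ((V ⊕ Fin (n + 1)) → ℕ) → Finset ℕ)
    (h1 : ∀ v' c c', (∀ u, (gluePetal G v n).Adj v' u → c u = c' u) → σ v' c = σ v' c')
    (h2 : ∀ v' c, (σ v' c).card ≤ s) (A : Finset ℕ) (hA : A.card ≤ s + 1) :
    ∃ p : Fin (n + 1) → ℕ, (∀ i, p i < 4 * (s * (s + 1)) - 1) ∧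
      ∀ a ∈ A, ∀ i, p i ∉ σ (Sum.inr i) (Sum.elim (fun _ => a) p) := by
  classical
  have ht : 1 ≤ s * (s + 1) := Nat.mul_pos hs (by omega)
  let F : ℕ → ℕ → ℕ → Finset ℕ := fun j z y =>
    if hj : j < n + 1 then
      A.biUnion (fun a => σ (Sum.inr ⟨j, hj⟩)
        (Sum.elim (fun _ => a) (fun i => if (i : ℕ) < j then z else y)))
    else ∅
  have hF : ∀ j z y, (F j z y).card ≤ s * (s + 1) := by
    intro j z y
    simp only [F]
    split_ifs with hj
    · refine (Finset.card_biUnion_le_card_mul _ _ s (fun a _ => h2 _ _)).trans ?_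
      rw [mul_comm]
      exact Nat.mul_le_mul_left _ hA
    · simp
  obtain ⟨e, he1, he2⟩ := path_lose _ ht F hF (n + 1)
  refine ⟨fun i => e (i + 1), fun i => he1 _, ?_⟩
  intro a ha i hi
  apply he2 i i.2
  simp only [F, i.2, dif_pos, Finset.mem_biUnion]
  refine ⟨a, ha, ?_⟩
  rw [h1 _ _ (Sum.elim (fun _ => a) (fun i => e (i + 1)))]
  · exact hi
  · rintro (u | u) hu
    · rfl
    · rw [glue_adj_inr_inr] at hu
      simp only [Sum.elim_inr]
      simp only [Fin.val_mk] at hu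
      rcases hu with hu | hu
      · rw [if_neg (by omega), ← hu]
      · rw [if_pos (by omega), hu]

lemma peel {V : Type} (G : SimpleGraph V) (v : V) (n s : ℕ) (hs : 1 ≤ s)
    (hw : HatWinning (gluePetal G v n) (fun _ => 4 * (s * (s + 1)) - 1) (fun _ => s)) :
    HatWinning G (fun _ => 4 * (s * (s + 1)) - 1) (fun _ => s) := by
  classical
  obtain ⟨σ, h1, h2, h3⟩ := hw
  set k := 4 * (s * (s + 1)) - 1 with hk
  let good : ℕ → (Fin (n + 1) → ℕ) → Prop := fun a p => (∀ i, p i < k) ∧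
      ∀ i, p i ∉ σ (Sum.inr i) (Sum.elim (fun _ => a) p)
  refine ⟨fun w g => if w = v then (Finset.range k).filter
      (fun a => ∀ p, good a p → a ∈ σ (Sum.inl v) (Sum.elim g p))
    else σ (Sum.inl w) (Sum.elim g (fun _ => 0)), ?_, ?_, ?_⟩
  · intro w c c' hc
    dsimp only
    split_ifs with hw
    · subst hw
      have : ∀ p, σ (Sum.inl w) (Sum.elim c p) = σ (Sum.inl w) (Sum.elim c' p) := by
        intro p
        apply h1
        rintro (u | u) hu
        · rw [glue_adj_inl_inl] at hu
          exact hc u hu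
        · rfl
      simp only [this]
    · apply h1
      rintro (u | u) hu
      · rw [glue_adj_inl_inl] at hu
        exact hc u hu
      · rfl
  · intro w g
    dsimp only
    split_ifs with hw
    · by_contra hcon
      obtain ⟨A, hA1, hA2⟩ := Finset.exists_subset_card_eq (Nat.succ_le_of_lt (not_le.1 hcon))
      obtain ⟨p, hp1, hp2⟩ := petal_lose G v n s hs σ h1 h2 A hA2.le
      have : A ⊆ σ (Sum.inl v) (Sum.elim g p) := by
        intro a ha
        exact (Finset.mem_filter.1 (hA1 ha)).2 p ⟨hp1, hp2 a ha⟩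
      have : A.card ≤ s := (Finset.card_le_card this).trans (h2 _ _)
      omega
    · exact h2 _ _
  · intro c hc
    by_contra hcon
    push Not at hcon
    have hv := hcon v
    rw [if_pos rfl, Finset.mem_filter, Finset.mem_range] at hv
    push Not at hv
    obtain ⟨p, ⟨hp1, hp2⟩, hp3⟩ := hv (hc v)
    obtain ⟨u, hu⟩ := h3 (Sum.elim c p) (by rintro (u | u); exacts [hc u, hp1 u])
    rcases u with u | u
    · rcases eq_or_ne u v with rfl | huv
      · exact hp3 hu
      · have hh := hcon u
        rw [if_neg huv] at hh
        apply hh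
        rw [h1 _ _ (Sum.elim c p)]
        · exact hu
        · rintro (x | x) hx
          · rfl
          · rw [glue_adj_inl_inr] at hx
            exact absurd hx huv
    · apply hp2 u
      rw [h1 _ _ (Sum.elim c p)]
      · exact hu
      · rintro (x | x) hx
        · rw [SimpleGraph.adj_comm, glue_adj_inl_inr] at hx
          subst hx
          rfl
        · rfl

lemma not_win {V : Type} (G : SimpleGraph V) (hG : IsRoyalPetunia G) (s : ℕ) (hs : 1 ≤ s) :
    ¬ HatWinning G (fun _ => 4 * (s * (s + 1)) - 1) (fun _ => s) := by
  induction hG with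
  | base n =>
    intro h
    obtain ⟨σ, h1, h2, h3⟩ := peel _ _ _ s hs h
    have : Finset.range (4 * (s * (s + 1)) - 1) ⊆ σ PUnit.unit (fun _ => 0) := by
      intro a ha
      obtain ⟨u, hu⟩ := h3 (fun _ => a) (fun _ => Finset.mem_range.1 ha)
      rwa [h1 u _ (fun _ => 0) (by simp)] at hu
    have : _ ≤ s := (Finset.card_le_card this).trans (h2 _ _)
    rw [Finset.card_range] at this
    have : s * 1 ≤ s * (s + 1) := Nat.mul_le_mul_left _ (by omega)
    omega
  | glue hG v n ih =>
    intro h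
    exact ih (peel _ _ _ s hs h)

/-! ### Lower bound -/

/-- Arc lengths for the path strategy. -/
def arcLen (h t : ℕ) : ℕ → ℕ
  | 0 => h
  | p + 1 => h - t * h / arcLen h t p

lemma arcLen_zero (t : ℕ) (ht : 1 ≤ t) :
    ∃ L, arcLen (4 * t - 2) t L = 0 ∧ ∀ p < L, 0 < arcLen (4 * t - 2) t p := by
  have hex : ∃ L, arcLen (4 * t - 2) t L = 0 := by
    by_contra hcon
    push Not at hcon
    have hdec : ∀ p, arcLen (4 * t - 2) t (p + 1) < arcLen (4 * t - 2) t p := by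
      intro p
      have hpos := Nat.pos_of_ne_zero (hcon p)
      have hle : arcLen (4 * t - 2) t p ≤ 4 * t - 2 := by
        cases p with
        | zero => exact le_rfl
        | succ p => exact Nat.sub_le _ _
      rw [arcLen]
      generalize arcLen (4 * t - 2) t p = m at hpos hle
      obtain ⟨r, hr⟩ := Nat.exists_eq_add_of_le hle
      have : r + 1 ≤ t * (4 * t - 2) / m := by
        rw [Nat.le_div_iff_mul_le hpos]
        have h4 : 4 * t - 2 = m + r := hr
        have h5 : 4 * (t : ℤ) - 2 = m + r := by omega
        rw [h4]
        zify
        have h6 : (0 : ℤ) ≤ (m - 2 * t) * (m - (2 * t - 1)) := by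
          rcases le_or_gt (2 * t : ℤ) m with h | h
          · exact mul_nonneg (by linarith) (by linarith)
          · exact mul_nonneg_of_nonpos_of_nonpos (by linarith) (by linarith [Int.le_sub_one_of_lt h])
        have h7 : (r : ℤ) = 4 * t - 2 - m := by linarith
        rw [h7]
        nlinarith
      omega
    have hb : ∀ p, arcLen (4 * t - 2) t p + p ≤ 4 * t - 2 := by
      intro p
      induction p with
      | zero => simp [arcLen]
      | succ p ih => have := hdec p; omega
    have := hb (4 * t - 2 + 1)
    omega
  classical
  exact ⟨Nat.find hex, Nat.find_spec hex, fun p hp => Nat.pos_of_ne_zero (Nat.find_min hex hp)⟩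

lemma path_win (t : ℕ) (ht : 1 ≤ t) :
    ∃ (L : ℕ) (g : ℕ → ℕ → ℕ → ℕ → ℕ), 0 < L ∧
      ∀ e : ℕ → ℕ, (∀ p < L, e (p + 1) < 4 * t - 2) →
        ∃ p < L, ∃ q < t, e (p + 1) = g p (e p) (e (p + 2)) q := by
  obtain ⟨L, hL0, hLpos⟩ := arcLen_zero t ht
  obtain ⟨h, hh⟩ : ∃ h, h = 4 * t - 2 := ⟨_, rfl⟩
  rw [← hh] at hL0 hLpos ⊢
  have hhpos : 0 < h := by omega
  haveI : NeZero h := ⟨hhpos.ne'⟩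
  let m := arcLen h t
  have hm0 : m 0 = h := rfl
  have hms : ∀ p, m (p + 1) = h - t * h / m p := fun p => rfl
  have hLp : 0 < L := by
    rcases Nat.eq_zero_or_pos L with rfl | hpos
    · simp [arcLen] at hL0; omega
    · exact hpos
  let x0 : ℕ → ℕ → ZMod h := fun p y => (m (p + 1) : ZMod h) * y + m (p + 1)
  let g : ℕ → ℕ → ℕ → ℕ → ℕ := fun p z y q =>
    (x0 p y + (((((z : ZMod h) - m p * x0 p y).val + h * q) / m p : ℕ) : ZMod h)).val
  refine ⟨L, g, hLp, ?_⟩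
  intro e he
  by_contra hcon
  push Not at hcon
  have key : ∀ p, p ≤ L → ((e p : ZMod h) - m p * (e (p + 1) : ZMod h)).val < m p := by
    intro p
    induction p with
    | zero => intro _; rw [hm0]; exact ZMod.val_lt _
    | succ p ih =>
      intro hp
      have ih := ih (by omega)
      by_contra hlt
      push Not at hlt
      have hmp : 0 < m p := hLpos p (by omega)
      set r := ((e p : ZMod h) - m p * (e (p + 1) : ZMod h)).val with hr
      set v := ((e (p + 1) : ZMod h) - m (p + 1) * (e (p + 1 + 1) : ZMod h)).val with hv
      have hvh : v < h := ZMod.val_lt _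
      obtain ⟨j, hj⟩ := Nat.exists_eq_add_of_le hlt
      have hjb : j < t * h / m p := by
        have := hms p
        omega
      have hr' : (r : ZMod h) = (e p : ZMod h) - m p * (e (p + 1) : ZMod h) := by
        rw [hr, ZMod.natCast_zmod_val]
      have hv' : (v : ZMod h) = (e (p + 1) : ZMod h) - m (p + 1) * (e (p + 2) : ZMod h) := by
        rw [hv, ZMod.natCast_zmod_val]
      have hx : (e (p + 1) : ZMod h) = x0 p (e (p + 2)) + j := by
        have : (e (p + 1) : ZMod h) = v + m (p + 1) * (e (p + 2) : ZMod h) := by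
          rw [hv']; ring
        rw [this, hj]
        simp only [x0]
        push_cast
        ring
      have hN : m p * j + r < t * h := by
        have h1 : (j + 1) * m p ≤ t * h := (Nat.le_div_iff_mul_le hmp).1 hjb
        nlinarith
      have hu : ((e p : ZMod h) - m p * x0 p (e (p + 2))).val = (m p * j + r) % h := by
        have : (e p : ZMod h) - m p * x0 p (e (p + 2)) = ((m p * j + r : ℕ) : ZMod h) := by
          push_cast
          rw [hr', hx]
          ring
        rw [this, ZMod.val_natCast]
      refine hcon p (by omega) ((m p * j + r) / h) ?_ ?_
      · rw [Nat.div_lt_iff_lt_mul hhpos]; exact hN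
      · simp only [g]
        rw [hu, Nat.mod_add_div, Nat.mul_add_div hmp, Nat.div_eq_of_lt ih, add_zero, ← hx,
          ZMod.val_natCast, Nat.mod_eq_of_lt (he p (by omega))]
  have := key L le_rfl
  have h0 : m L = 0 := hL0
  omega

/-- Colors seen on the path, shifted by one and extended by zero. -/
def pathCol (n : ℕ) (c : PUnit.{1} ⊕ Fin (n + 1) → ℕ) : ℕ → ℕ
  | 0 => 0
  | j + 1 => if hj : j < n + 1 then c (Sum.inr ⟨j, hj⟩) else 0

lemma exists_win (s : ℕ) (hs : 1 ≤ s) :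
    ∃ n, HatWinning (gluePetal (⊥ : SimpleGraph PUnit) PUnit.unit n)
      (fun _ => 4 * (s * (s + 1)) - 2) (fun _ => s) := by
  classical
  have ht : 1 ≤ s * (s + 1) := Nat.mul_pos hs (by omega)
  obtain ⟨L, g, hL, hg⟩ := path_win _ ht
  set h := 4 * (s * (s + 1)) - 2 with hh
  -- enumeration of all maps from colors to parts
  let Φ := Fin h → Fin (s + 1)
  let M := Fintype.card Φ
  let enc : Φ ≃ Fin M := Fintype.equivFin Φ
  let part : ℕ → ℕ → ℕ := fun b a =>
    if hb : b < M then if ha : a < h then (enc.symm ⟨b, hb⟩ ⟨a, ha⟩ : ℕ) else 0 else 0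
  let n := M * L
  -- guess of path vertex `i`, with stem color `a`
  let gs : ℕ → ℕ → ℕ → ℕ → Finset ℕ := fun i a z y =>
    (Finset.range s).image (fun q => g (i % L) z y (part (i / L) a * s + q))
  let pg : Fin (n + 1) → ℕ → (PUnit.{1} ⊕ Fin (n + 1) → ℕ) → Finset ℕ := fun i a c =>
    gs i a (pathCol n c i) (pathCol n c (i + 2))
  let B : (PUnit.{1} ⊕ Fin (n + 1) → ℕ) → Finset ℕ := fun c =>
    (Finset.range h).filter (fun a => ∀ i : Fin (n + 1), c (Sum.inr i) ∉ pg i a c)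
  refine ⟨n, fun v c => Sum.elim (fun _ => if (B c).card ≤ s then B c else ∅)
    (fun i => pg i (c (Sum.inl PUnit.unit)) c) v, ?_, ?_, ?_⟩
  · rintro (v | i) c c' hc
    · have e1 : ∀ i : Fin (n + 1), c (Sum.inr i) = c' (Sum.inr i) := fun i =>
        hc _ ((glue_adj_inl_inr _ _ _ _ _).2 rfl)
      have e2 : pathCol n c = pathCol n c' := by
        funext j
        cases j with
        | zero => rfl
        | succ j => simp only [pathCol, e1]
      have e3 : B c = B c' := by simp only [B, pg, e1, e2]
      simp only [Sum.elim_inl, e3]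
    · have e1 : c (Sum.inl PUnit.unit) = c' (Sum.inl PUnit.unit) :=
        hc _ (((glue_adj_inl_inr _ _ _ _ _).2 rfl).symm)
      have e2 : pathCol n c i = pathCol n c' i := by
        rcases i with ⟨i, hi⟩
        cases i with
        | zero => rfl
        | succ j =>
          simp only [pathCol]
          split_ifs with hj
          · exact hc _ ((glue_adj_inr_inr _ _ _ _ _).2 (Or.inr rfl))
          · rfl
      have e3 : pathCol n c (i + 2) = pathCol n c' (i + 2) := by
        simp only [pathCol]
        split_ifs with hj
        · exact hc _ ((glue_adj_inr_inr _ _ _ _ _).2 (Or.inl rfl))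
        · rfl
      simp only [Sum.elim_inr, pg, e1, e2, e3]
  · rintro (v | i) c
    · simp only [Sum.elim_inl]
      split_ifs with h'
      · exact h'
      · simp
    · simp only [Sum.elim_inr, pg, gs]
      exact Finset.card_image_le.trans (by simp)
  · intro c hc
    by_contra hcon
    push Not at hcon
    have hBc : (B c).card ≤ s := by
      by_contra hbig
      obtain ⟨A, hA1, hA2⟩ := Finset.exists_subset_card_eq (Nat.succ_le_of_lt (not_le.1 hbig))
      let eA : A ≃ Fin (s + 1) := A.equivFinOfCardEq hA2
      let φ : Φ := fun a => if ha : (a : ℕ) ∈ A then eA ⟨a, ha⟩ else 0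
      let b := enc φ
      -- section number `b`
      have hbL : ∀ p < L, b * L + p < n := by
        intro p hp
        have : (b + 1) * L ≤ M * L := Nat.mul_le_mul_right _ b.2
        have h2 : ((b : ℕ) + 1) * L = b * L + L := by ring
        simp only [n]
        omega
      have hcol : ∀ i (hi : i < n + 1), pathCol n c (i + 1) = c (Sum.inr ⟨i, hi⟩) := by
        intro i hi
        simp only [pathCol, hi, dif_pos]
      obtain ⟨p, hp, q, hq, hpq⟩ := hg (fun p => pathCol n c (b * L + p)) (by
        intro p hp
        have h1 := hbL p hp
        have := hcol (b * L + p) (by omega)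
        rw [add_assoc] at this
        simp only [this]
        exact hc _)
      have hqs : q / s < s + 1 := by
        rw [Nat.div_lt_iff_lt_mul (by omega), mul_comm]; exact hq
      obtain ⟨⟨a, haA⟩, ha⟩ := eA.surjective ⟨q / s, hqs⟩
      have haB := hA1 haA
      simp only [B, Finset.mem_filter, Finset.mem_range] at haB
      have hi : b * L + p < n + 1 := by have := hbL p hp; omega
      apply haB.2 ⟨b * L + p, hi⟩
      rw [← hcol]
      simp only [pg, gs, Finset.mem_image, Finset.mem_range]
      have hdiv : ((b : ℕ) * L + p) / L = b := by
        rw [mul_comm, Nat.mul_add_div hL, Nat.div_eq_of_lt hp, add_zero]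
      have hmod : ((b : ℕ) * L + p) % L = p := by
        rw [mul_comm, Nat.mul_add_mod, Nat.mod_eq_of_lt hp]
      have hpart : part b a = q / s := by
        simp only [part, b.2, dif_pos, haB.1, Fin.eta]
        simp only [b, Equiv.symm_apply_apply, φ, haA, dif_pos, ha]
      refine ⟨q % s, Nat.mod_lt _ (by omega), ?_⟩
      rw [hdiv, hmod, hpart, Nat.div_add_mod']
      exact hpq.symm
    have hv := hcon (Sum.inl PUnit.unit)
    simp only [Sum.elim_inl, hBc, if_true] at hv
    apply hv
    simp only [B, Finset.mem_filter, Finset.mem_range]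
    exact ⟨hc _, fun i => hcon (Sum.inr i)⟩

/-- For every royal petunia `G`, `HG_s(G) ≤ 4s(s+1)-2`, and the bound is
attained by some royal petunia; hence the supremum of `HG_s` over royal petunias is
`4s(s+1)-2`. -/
theorem royal_petunia_HG (s : ℕ) (hs : 1 ≤ s) :
    (∀ (V : Type) (G : SimpleGraph V), IsRoyalPetunia G →
      ∀ k, HatWinning G (fun _ => k) (fun _ => s) → k ≤ 4 * s * (s + 1) - 2) ∧
    (∃ (V : Type) (G : SimpleGraph V), IsRoyalPetunia G ∧
      HatWinning G (fun _ => 4 * s * (s + 1) - 2) (fun _ => s)) := by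
  have e : 4 * s * (s + 1) = 4 * (s * (s + 1)) := by ring
  rw [e]
  constructor
  · intro V G hG k hk
    by_contra hlt
    apply not_win G hG s hs
    obtain ⟨σ, h1, h2, h3⟩ := hk
    refine ⟨σ, h1, h2, fun c hc => h3 c fun v => ?_⟩
    have := hc v
    dsimp only at this ⊢
    omega
  · obtain ⟨n, hn⟩ := exists_win s hs
    exact ⟨_, _, IsRoyalPetunia.base n, hn⟩
end
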